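/- Let (x_n)_{n∈N} be a bounded family in a Banach space X (N countable), with x_n ≠ 0 for some n ∈ N. Then the dual sequence of the fundamental function of (x_n), i.e., the sequence m ↦ m/φ_u(m), is nondecreasing. -/

import Mathlib

open scoped BigOperators ENNReal NNReal
open MeasureTheory

noncomputable section

namespace GreedyRenorm

/-! ### Sequence notions.  Sequences are indexed by `ℕ`, understood as defined on the
positive integers, with the convention that the value at `0` is `0` where relevant. -/

/-- `σ` is nondecreasing (on the positive integers). -/
def MonoFrom1 (σ : ℕ → ℝ) : Prop := ∀ m : ℕ, 1 ≤ m → σ m ≤ σ (m + 1)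

/-- The dual sequence `σ*(m) = m / σ(m)` is nondecreasing (on the positive integers). -/
def DualMonoFrom1 (σ : ℕ → ℝ) : Prop :=
  ∀ m : ℕ, 1 ≤ m → (m : ℝ) / σ m ≤ ((m : ℝ) + 1) / σ (m + 1)

/-- Lower regularity property: `σ (r m) ≥ 2 σ m` for some positive integer `r`. -/
def HasLRP (σ : ℕ → ℝ) : Prop :=
  ∃ r : ℕ, 1 ≤ r ∧ ∀ m : ℕ, 1 ≤ m → 2 * σ m ≤ σ (r * m)

/-- Upper regularity property: `σ (r m) ≤ (r/2) σ m` for some positive integer `r`. -/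
def HasURP (σ : ℕ → ℝ) : Prop :=
  ∃ r : ℕ, 1 ≤ r ∧ ∀ m : ℕ, 1 ≤ m → σ (r * m) ≤ ((r : ℝ) / 2) * σ m

/-- Dini regularity: the discrete derivative of `σ` is equivalent to `σ(m)/m`. -/
def DiniRegular (σ : ℕ → ℝ) : Prop :=
  ∃ C : ℝ, 1 ≤ C ∧ ∀ m : ℕ, 1 ≤ m →
    (1 / C) * (σ m / (m : ℝ)) ≤ σ m - σ (m - 1) ∧
      σ m - σ (m - 1) ≤ C * (σ m / (m : ℝ))

/-- `σ` and `τ` are equivalent sequences (on the positive integers). -/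
def EquivSeq (σ τ : ℕ → ℝ) : Prop :=
  ∃ D : ℝ, 1 ≤ D ∧ ∀ m : ℕ, 1 ≤ m → (1 / D) * τ m ≤ σ m ∧ σ m ≤ D * τ m

/-- `σ` is a Dini regularization of `τ`: it is Dini-regular and equivalent to `τ`
(with the convention `σ 0 = 0`). -/
def DiniRegularization (σ τ : ℕ → ℝ) : Prop :=
  σ 0 = 0 ∧ DiniRegular σ ∧ EquivSeq σ τ

/-- A Dini regularization of `τ` which is positive and such that both it and its dual
sequence are nondecreasing. -/
def GoodDiniReg (σ τ : ℕ → ℝ) : Prop :=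
  DiniRegularization σ τ ∧ (∀ m : ℕ, 1 ≤ m → 0 < σ m) ∧ MonoFrom1 σ ∧ DualMonoFrom1 σ

/-! ### Fundamental functions and norms -/

/-- The fundamental function of a family `y` computed with respect to a gauge `ν`:
`m ↦ sup { ν (∑_{n ∈ A} ε n • y n) : |A| ≤ m, |ε n| = 1 }`. -/
def fundFunWith (𝕜 : Type*) [RCLike 𝕜] {N Y : Type*} [AddCommGroup Y] [Module 𝕜 Y]
    (ν : Y → ℝ) (y : N → Y) (m : ℕ) : ℝ :=
  sSup {r : ℝ | ∃ (A : Finset N) (ε : N → 𝕜), A.card ≤ m ∧ (∀ n, ‖ε n‖ = 1) ∧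
    r = ν (∑ n ∈ A, ε n • y n)}

/-- The fundamental function of a family `y` in a normed space. -/
def fundFun (𝕜 : Type*) [RCLike 𝕜] {N Y : Type*} [SeminormedAddCommGroup Y]
    [NormedSpace 𝕜 Y] (y : N → Y) (m : ℕ) : ℝ :=
  fundFunWith 𝕜 (fun v => ‖v‖) y m

/-- `ν` is an equivalent norm on the normed space `X`. -/
structure IsEquivNorm (𝕜 : Type*) [RCLike 𝕜] {X : Type*} [NormedAddCommGroup X]
    [NormedSpace 𝕜 X] (ν : X → ℝ) : Prop where
  add_le : ∀ f g : X, ν (f + g) ≤ ν f + ν g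
  smul_eq : ∀ (a : 𝕜) (f : X), ν (a • f) = ‖a‖ * ν f
  lower : ∃ c : ℝ, 0 < c ∧ ∀ f : X, c * ‖f‖ ≤ ν f
  upper : ∃ C : ℝ, 0 < C ∧ ∀ f : X, ν f ≤ C * ‖f‖

section Basis

variable {𝕜 : Type*} [RCLike 𝕜] {N : Type*} {X : Type*}
  [NormedAddCommGroup X] [NormedSpace 𝕜 X]

/-- The dual norm, relative to the gauge `ν` on `X`, of a functional `g`. -/
def dualNormWith (ν : X → ℝ) (g : X →L[𝕜] 𝕜) : ℝ :=
  sSup {r : ℝ | ∃ f : X, ν f ≤ 1 ∧ r = ‖g f‖}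

/-- The fundamental function of the dual system `xs`, computed with the dual norm of `ν`. -/
def dualFundFunWith (ν : X → ℝ) (xs : N → X →L[𝕜] 𝕜) (m : ℕ) : ℝ :=
  sSup {r : ℝ | ∃ (B : Finset N) (δ : N → 𝕜), B.card ≤ m ∧ (∀ n, ‖δ n‖ = 1) ∧
    r = dualNormWith ν (∑ n ∈ B, δ n • xs n)}

/-- `A` is a greedy set of `f` with respect to the coordinate functionals `xs`. -/
def GreedySet (xs : N → X →L[𝕜] 𝕜) (f : X) (A : Finset N) : Prop :=
  ∀ n ∈ A, ∀ k, k ∉ A → ‖xs k f‖ ≤ ‖xs n f‖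

/-- `S_A(f) = ∑_{n ∈ A} x_n^*(f) • x_n`. -/
def greedyProj (x : N → X) (xs : N → X →L[𝕜] 𝕜) (A : Finset N) (f : X) : X :=
  ∑ n ∈ A, xs n f • x n

/-- A complete minimal system with its (biorthogonal) dual system. -/
structure IsCompleteMinimal (x : N → X) (xs : N → X →L[𝕜] 𝕜) : Prop where
  dense_span : (Submodule.span 𝕜 (Set.range x)).topologicalClosure = ⊤
  biorth_diag : ∀ n, xs n (x n) = 1
  biorth_off : ∀ n k, n ≠ k → xs n (x k) = 0

/-- A basis: a complete minimal system which is semi-normalized and `M`-bounded. -/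
structure IsBasis (x : N → X) (xs : N → X →L[𝕜] 𝕜) : Prop where
  dense_span : (Submodule.span 𝕜 (Set.range x)).topologicalClosure = ⊤
  biorth_diag : ∀ n, xs n (x n) = 1
  biorth_off : ∀ n k, n ≠ k → xs n (x k) = 0
  norm_pos : ∃ c : ℝ, 0 < c ∧ ∀ n, c ≤ ‖x n‖
  norm_bdd : ∃ C : ℝ, ∀ n, ‖x n‖ ≤ C
  mBounded : ∃ C : ℝ, ∀ n, ‖x n‖ * ‖xs n‖ ≤ C

/-- The basis is `C`-greedy with respect to the gauge `ν`. -/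
def GreedyWith (ν : X → ℝ) (x : N → X) (xs : N → X →L[𝕜] 𝕜) (C : ℝ) : Prop :=
  ∀ (f : X) (A B : Finset N) (a : N → 𝕜), GreedySet xs f A → B.card ≤ A.card →
    ν (f - greedyProj x xs A f) ≤ C * ν (f - ∑ n ∈ B, a n • x n)

/-- The basis is `C`-almost greedy with respect to the gauge `ν`. -/
def AlmostGreedyWith (ν : X → ℝ) (x : N → X) (xs : N → X →L[𝕜] 𝕜) (C : ℝ) : Prop :=
  ∀ (f : X) (A B : Finset N), GreedySet xs f A → B.card ≤ A.card →
    ν (f - greedyProj x xs A f) ≤ C * ν (f - greedyProj x xs B f)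

/-- The basis is `C`-quasi-greedy with respect to the gauge `ν`. -/
def QuasiGreedyWith (ν : X → ℝ) (x : N → X) (xs : N → X →L[𝕜] 𝕜) (C : ℝ) : Prop :=
  ∀ (f : X) (A : Finset N), GreedySet xs f A → ν (greedyProj x xs A f) ≤ C * ν f

/-- The basis is lattice `C`-unconditional with respect to the gauge `ν`. -/
def LatticeUnconditionalWith (ν : X → ℝ) (x : N → X) (xs : N → X →L[𝕜] 𝕜) (C : ℝ) : Prop :=
  ∀ (f : X) (A : Finset N) (lam : N → 𝕜) (M : ℝ), (∀ n, ‖lam n‖ ≤ M) →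
    ν (∑ n ∈ A, lam n • xs n f • x n) ≤ C * M * ν f

/-- The basis is suppression `C`-unconditional (with respect to the ambient norm). -/
def SuppressionUnconditional (x : N → X) (xs : N → X →L[𝕜] 𝕜) (C : ℝ) : Prop :=
  ∀ (f : X) (A : Finset N), ‖greedyProj x xs A f‖ ≤ C * ‖f‖

/-- The family `x` is `C`-democratic (with respect to the ambient norm). -/
def Democratic (x : N → X) (C : ℝ) : Prop :=
  ∀ A B : Finset N, A.card ≤ B.card → ‖∑ n ∈ A, x n‖ ≤ C * ‖∑ n ∈ B, x n‖

/-- The basis is `C`-bidemocratic (with respect to the ambient norm; the dual system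
carries the operator norm). -/
def Bidemocratic (x : N → X) (xs : N → X →L[𝕜] 𝕜) (C : ℝ) : Prop :=
  ∀ (A B : Finset N) (ε δ : N → 𝕜), (∀ n, ‖ε n‖ = 1) → (∀ n, ‖δ n‖ = 1) →
    ‖∑ n ∈ A, ε n • x n‖ * ‖∑ n ∈ B, δ n • xs n‖ ≤ C * (max A.card B.card : ℕ)

/-- The basis is `C`-bidemocratic with respect to the gauge `ν` (the dual system carries
the corresponding dual norm). -/
def BidemocraticWith (ν : X → ℝ) (x : N → X) (xs : N → X →L[𝕜] 𝕜) (C : ℝ) : Prop :=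
  ∀ (A B : Finset N) (ε δ : N → 𝕜), (∀ n, ‖ε n‖ = 1) → (∀ n, ‖δ n‖ = 1) →
    ν (∑ n ∈ A, ε n • x n) * dualNormWith ν (∑ n ∈ B, δ n • xs n) ≤
      C * (max A.card B.card : ℕ)

/-- Property (A) with respect to the gauge `ν`. -/
def PropertyAWith (ν : X → ℝ) (x : N → X) (xs : N → X →L[𝕜] 𝕜) : Prop :=
  ∀ (A B : Finset N) (ε δ : N → 𝕜) (g : X),
    A.card ≤ B.card → Disjoint A B → (∀ n, ‖ε n‖ = 1) → (∀ n, ‖δ n‖ = 1) →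
    (∀ n, (n ∈ A ∨ n ∈ B) → xs n g = 0) → (∀ n, ‖xs n g‖ ≤ 1) →
    ν ((∑ n ∈ A, ε n • x n) + g) ≤ ν ((∑ n ∈ B, δ n • x n) + g)

end Basis

/-- The basis `x` (indexed by `ℕ`) is `C`-subsymmetric with respect to the gauge `ν`:
every "dilated sign change" extends to an isomorphism onto its range with distortion
constants at most `C`. -/
def SubsymWith (𝕜 : Type*) [RCLike 𝕜] {X : Type*} [NormedAddCommGroup X]
    [NormedSpace 𝕜 X] (ν : X → ℝ) (x : ℕ → X) (C : ℝ) : Prop :=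
  ∀ (lam : ℕ → 𝕜), (∀ n, ‖lam n‖ = 1) → ∀ β : ℕ → ℕ, StrictMono β →
    ∃ T : X →L[𝕜] X, (∀ n, T (x n) = lam n • x (β n)) ∧
      (∀ f : X, ν (T f) ≤ C * ν f) ∧ (∀ f : X, ν f ≤ C * ν (T f))

/-- `X` has nontrivial Rademacher cotype. -/
def NontrivialCotype (X : Type*) [SeminormedAddCommGroup X] : Prop :=
  ∃ q C : ℝ, 0 < q ∧ 0 < C ∧ ∀ (n : ℕ) (f : Fin n → X),
    (∑ i, ‖f i‖ ^ q) ^ (1 / q) ≤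
      C * (((2 : ℝ) ^ n)⁻¹ * ∑ ε : Fin n → Bool, ‖∑ i, (if ε i then f i else -f i)‖)

/-- `X` has nontrivial Rademacher type. -/
def NontrivialType (X : Type*) [SeminormedAddCommGroup X] : Prop :=
  ∃ p C : ℝ, 1 < p ∧ 0 < C ∧ ∀ (n : ℕ) (f : Fin n → X),
    ((2 : ℝ) ^ n)⁻¹ * ∑ ε : Fin n → Bool, ‖∑ i, (if ε i then f i else -f i)‖ ≤
      C * (∑ i, ‖f i‖ ^ p) ^ (1 / p)

end GreedyRenorm
namespace GreedyRenorm

section FundFun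

variable {𝕜 : Type*} [RCLike 𝕜] {N X : Type*} [SeminormedAddCommGroup X] [NormedSpace 𝕜 X]

theorem norm_sum_smul_le_fundFun {x : N → X} (hbdd : ∃ C : ℝ, ∀ n, ‖x n‖ ≤ C)
    {m : ℕ} {A : Finset N} (hA : A.card ≤ m) {ε : N → 𝕜} (hε : ∀ n, ‖ε n‖ = 1) :
    ‖∑ n ∈ A, ε n • x n‖ ≤ fundFun 𝕜 x m := by
  obtain ⟨C, hC⟩ := hbdd
  refine le_csSup ⟨m * |C|, ?_⟩ ⟨A, ε, hA, hε, rfl⟩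
  rintro r ⟨B, δ, hB, hδ, rfl⟩
  calc ‖∑ n ∈ B, δ n • x n‖ ≤ B.card • |C| := by
        refine norm_sum_le_of_le _ (fun n _ => ?_) |>.trans_eq (Finset.sum_const _)
        rw [norm_smul, hδ, one_mul]
        exact (hC n).trans (le_abs_self C)
    _ ≤ m * |C| := by
        rw [nsmul_eq_mul]
        gcongr

theorem fundFun_le {x : N → X} {m : ℕ} {b : ℝ}
    (h : ∀ (A : Finset N) (ε : N → 𝕜), A.card ≤ m → (∀ n, ‖ε n‖ = 1) →
      ‖∑ n ∈ A, ε n • x n‖ ≤ b) :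
    fundFun 𝕜 x m ≤ b := by
  refine csSup_le ⟨_, ∅, fun _ => 1, by simp, by simp, rfl⟩ ?_
  rintro r ⟨A, ε, hA, hε, rfl⟩
  exact h A ε hA hε

theorem fundFun_pos {x : N → X} (hbdd : ∃ C : ℝ, ∀ n, ‖x n‖ ≤ C) (hne : ∃ n, 0 < ‖x n‖)
    {m : ℕ} (hm : 1 ≤ m) : 0 < fundFun 𝕜 x m := by
  obtain ⟨n, hn⟩ := hne
  have h := norm_sum_smul_le_fundFun (𝕜 := 𝕜) hbdd (A := {n}) (m := m) (by simpa using hm)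
    (ε := fun _ => 1) (by simp)
  simp only [Finset.sum_singleton, one_smul] at h
  exact hn.trans_le h

theorem _root_.Finset.sum_sum_erase_eq_nsmul {ι M : Type*} [DecidableEq ι] [AddCommGroup M]
    (A : Finset ι) (f : ι → M) {m : ℕ} (hA : A.card = m + 1) :
    ∑ k ∈ A, ∑ n ∈ A.erase k, f n = m • ∑ n ∈ A, f n := by
  have h : ∀ k ∈ A, ∑ n ∈ A.erase k, f n = ∑ n ∈ A, f n - f k := fun k hk =>
    Finset.sum_erase_eq_sub hk
  rw [Finset.sum_congr rfl h, Finset.sum_sub_distrib, Finset.sum_const, hA, succ_nsmul,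
    add_sub_cancel_right]

theorem mul_fundFun_succ_le {x : N → X} (hbdd : ∃ C : ℝ, ∀ n, ‖x n‖ ≤ C) {m : ℕ}
    (hm : 1 ≤ m) : m * fundFun 𝕜 x (m + 1) ≤ (m + 1) * fundFun 𝕜 x m := by
  classical
  have hm' : (0 : ℝ) < m := by exact_mod_cast hm
  rw [← le_div_iff₀' hm']
  refine fundFun_le fun A ε hA hε => ?_
  rw [le_div_iff₀' hm']
  rcases hA.lt_or_eq with hlt | heq
  · have h := norm_sum_smul_le_fundFun hbdd (Nat.lt_succ_iff.mp hlt) hε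
    have := norm_nonneg (∑ n ∈ A, ε n • x n)
    nlinarith
  · calc (m : ℝ) * ‖∑ n ∈ A, ε n • x n‖ = ‖∑ k ∈ A, ∑ n ∈ A.erase k, ε n • x n‖ := by
          rw [A.sum_sum_erase_eq_nsmul _ heq, ← Nat.cast_smul_eq_nsmul 𝕜, norm_smul,
            RCLike.norm_natCast]
      _ ≤ ∑ k ∈ A, fundFun 𝕜 x m := norm_sum_le_of_le _ fun k hk =>
          norm_sum_smul_le_fundFun hbdd (by rw [Finset.card_erase_of_mem hk, heq]; simp) hε
      _ = (m + 1) * fundFun 𝕜 x m := by simp [heq]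

end FundFun

/-- Lemma 2.1: for a bounded family in a Banach space with some nonzero
member, the dual sequence `m ↦ m / φ_u(m)` of the fundamental function is nondecreasing. -/
theorem dualSeq_fundFun_monotone {𝕜 : Type*} [RCLike 𝕜] {N : Type*} [Countable N]
    {X : Type*} [NormedAddCommGroup X] [NormedSpace 𝕜 X] [CompleteSpace X]
    (x : N → X) (hbdd : ∃ C : ℝ, ∀ n, ‖x n‖ ≤ C) (hne : ∃ n, x n ≠ 0) :
    DualMonoFrom1 (fundFun 𝕜 x) := by
  intro m hm
  have hne' : ∃ n, 0 < ‖x n‖ := hne.imp fun n hn => norm_pos_iff.mpr hn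
  rw [div_le_div_iff₀ (fundFun_pos hbdd hne' hm) (fundFun_pos hbdd hne' (by omega))]
  exact mul_fundFun_succ_le hbdd hm

end GreedyRenorm
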